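/- arXiv:math/9906033 — 2 statements merged into one kernel-verified Lean document; each statement's English description precedes it below -/
import Mathlib

section
/- Let V be a set and let 𝓔, 𝓕 be families of finite subsets of V. Then the empty set belongs to [𝓔]_𝓕 if and only if the empty set belongs to [𝓕]_𝓔. -/
/-- The closure of `𝓐` under resolution on members of `𝓓`: the smallest family
containing `𝓐` such that whenever `d ∈ 𝓓` and for each `v ∈ d` we have a set
`c v` in the closure with `v ∈ c v`, the resolvent `⋃ v ∈ d, c v \ {v}` is
also in the closure. -/
inductive ResClosure {V : Type*} (𝓐 𝓓 : Set (Set V)) : Set V → Prop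
  | base {c : Set V} (hc : c ∈ 𝓐) : ResClosure 𝓐 𝓓 c
  | res {d : Set V} (hd : d ∈ 𝓓) (c : V → Set V)
      (hmem : ∀ v ∈ d, v ∈ c v) (hcl : ∀ v ∈ d, ResClosure 𝓐 𝓓 (c v)) :
      ResClosure 𝓐 𝓓 (⋃ v ∈ d, c v \ {v})

/-- `[𝓐]_𝓓`, the resolution closure as a family of sets. -/
def resSet {V : Type*} (𝓐 𝓓 : Set (Set V)) : Set (Set V) :=
  {e | ResClosure 𝓐 𝓓 e}

/-- A set `W` that meets every member of `𝓐` and contains no member of `𝓓` meets every member of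
the resolution closure. -/
theorem ResClosure.inter_nonempty {V : Type*} {𝓐 𝓓 : Set (Set V)} {W : Set V}
    (hA : ∀ c ∈ 𝓐, (c ∩ W).Nonempty) (hD : ∀ d ∈ 𝓓, ¬ d ⊆ W) {e : Set V}
    (he : ResClosure 𝓐 𝓓 e) : (e ∩ W).Nonempty := by
  induction he with
  | base hc => exact hA _ hc
  | @res d hd c hmem hcl ih =>
    obtain ⟨v, hvd, hvW⟩ := Set.not_subset.1 (hD d hd)
    obtain ⟨w, hwc, hwW⟩ := ih v hvd
    refine ⟨w, Set.mem_biUnion hvd ⟨hwc, ?_⟩, hwW⟩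
    rintro rfl
    exact hvW hwW

theorem ResClosure.finite {V : Type*} {𝓐 𝓓 : Set (Set V)}
    (hA : ∀ c ∈ 𝓐, c.Finite) (hD : ∀ d ∈ 𝓓, d.Finite) {e : Set V}
    (he : ResClosure 𝓐 𝓓 e) : e.Finite := by
  induction he with
  | base hc => exact hA _ hc
  | res hd c hmem hcl ih => exact (hD _ hd).biUnion fun v hv => (ih v hv).sdiff

/-- A finite set meeting every member of a nonempty chain meets its intersection. -/
theorem IsChain.inter_sInter_nonempty {V : Type*} {C : Set (Set V)}
    (hC : IsChain (· ⊆ ·) C) (hne : C.Nonempty) {s : Set V} (hs : s.Finite)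
    (h : ∀ W ∈ C, (s ∩ W).Nonempty) : (s ∩ ⋂₀ C).Nonempty := by
  by_contra hcon
  have hmiss : ∀ v ∈ s, ∃ W ∈ C, v ∉ W := by
    intro v hv
    by_contra! hall
    exact hcon ⟨v, hv, hall⟩
  have key : ∃ W ∈ C, ∀ v ∈ s, v ∉ W := by
    clear h hcon
    induction s, hs using Set.Finite.induction_on with
    | empty => exact hne.imp fun W hW => ⟨hW, by simp⟩
    | @insert a t _ _ ih =>
      obtain ⟨W, hW, hWt⟩ := ih fun v hv => hmiss v (Set.mem_insert_of_mem a hv)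
      obtain ⟨U, hU, haU⟩ := hmiss a (Set.mem_insert a t)
      rcases hC.total hW hU with hle | hle
      · exact ⟨W, hW, Set.forall_mem_insert.2 ⟨fun ha => haU (hle ha), hWt⟩⟩
      · exact ⟨U, hU, Set.forall_mem_insert.2 ⟨haU, fun v hv hvU => hWt v hv (hle hvU)⟩⟩
  obtain ⟨W, hW, hWs⟩ := key
  obtain ⟨v, hv, hvW⟩ := h W hW
  exact hWs v hv hvW

/-- A family of finite nonempty sets has a minimal transversal. -/
theorem exists_minimal_transversal {V : Type*} {𝓒 : Set (Set V)}
    (hfin : ∀ c ∈ 𝓒, c.Finite) (hne : ∀ c ∈ 𝓒, c.Nonempty) :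
    ∃ W : Set V, Minimal (fun W => ∀ c ∈ 𝓒, (c ∩ W).Nonempty) W := by
  refine zorn_superset {W : Set V | ∀ c ∈ 𝓒, (c ∩ W).Nonempty} fun C hCS hC => ?_
  rcases C.eq_empty_or_nonempty with rfl | hCne
  · exact ⟨Set.univ, by simpa using hne, by simp⟩
  · exact ⟨⋂₀ C, fun c hc => hC.inter_sInter_nonempty hCne (hfin c hc) fun W hW => hCS hW c hc,
      fun W hW => Set.sInter_subset_of_mem hW⟩

/-- If the empty set is not derivable, some set meets every member of `𝓐` and contains no member
of `𝓓`. -/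
theorem exists_transversal_of_empty_notMem_resSet {V : Type*} {𝓐 𝓓 : Set (Set V)}
    (hA : ∀ c ∈ 𝓐, c.Finite) (hD : ∀ d ∈ 𝓓, d.Finite) (h : ∅ ∉ resSet 𝓐 𝓓) :
    ∃ W : Set V, (∀ c ∈ 𝓐, (c ∩ W).Nonempty) ∧ ∀ d ∈ 𝓓, ¬ d ⊆ W := by
  have hne : ∀ c ∈ resSet 𝓐 𝓓, c.Nonempty := fun c hc =>
    Set.nonempty_iff_ne_empty.2 fun h0 => h (h0 ▸ hc)
  obtain ⟨W, hW⟩ := exists_minimal_transversal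
    (fun c (hc : c ∈ resSet 𝓐 𝓓) => ResClosure.finite hA hD hc) hne
  refine ⟨W, fun c hc => hW.prop c (.base hc), fun d hd hdW => ?_⟩
  have hcrit : ∀ v ∈ W, ∃ c ∈ resSet 𝓐 𝓓, c ∩ W ⊆ {v} := by
    intro v hv
    by_contra! hall
    refine (hW.le_of_le (y := W \ {v}) (fun c hc => ?_) Set.sdiff_subset hv).2 rfl
    obtain ⟨w, ⟨hwc, hwW⟩, hwv⟩ := Set.not_subset.1 (hall c hc)
    exact ⟨w, hwc, hwW, hwv⟩
  choose! c hc hcW using hcrit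
  have hmem : ∀ v ∈ d, v ∈ c v := fun v hv => by
    obtain ⟨w, hw⟩ := hW.prop (c v) (hc v (hdW hv))
    obtain rfl : w = v := hcW v (hdW hv) hw
    exact hw.1
  obtain ⟨w, hw, hwW⟩ := hW.prop _ (ResClosure.res hd c hmem fun v hv => hc v (hdW hv))
  obtain ⟨v, hv, hwc, hwv⟩ := Set.mem_iUnion₂.1 hw
  exact hwv (hcW v (hdW hv) ⟨hwc, hwW⟩)

theorem empty_mem_resSet_of_swap {V : Type*} {𝓐 𝓓 : Set (Set V)}
    (hA : ∀ c ∈ 𝓐, c.Finite) (hD : ∀ d ∈ 𝓓, d.Finite) (h : ∅ ∈ resSet 𝓓 𝓐) :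
    ∅ ∈ resSet 𝓐 𝓓 := by
  by_contra hcon
  obtain ⟨W, hWA, hWD⟩ := exists_transversal_of_empty_notMem_resSet hA hD hcon
  have hmeet : (∅ ∩ Wᶜ).Nonempty := ResClosure.inter_nonempty
    (fun d hd => Set.not_subset.1 (hWD d hd))
    (fun c hc hcW => let ⟨_, hvc, hvW⟩ := hWA c hc; hcW hvc hvW) h
  simp at hmeet

/-- `∅ ∈ [𝓔]_𝓕` iff `∅ ∈ [𝓕]_𝓔`. -/
theorem empty_mem_resSet_comm {V : Type*} (𝓔 𝓕 : Set (Set V))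
    (hE : ∀ E ∈ 𝓔, E.Finite) (hF : ∀ F ∈ 𝓕, F.Finite) :
    ∅ ∈ resSet 𝓔 𝓕 ↔ ∅ ∈ resSet 𝓕 𝓔 := by
  exact ⟨empty_mem_resSet_of_swap hF hE, empty_mem_resSet_of_swap hE hF⟩
end

section
/- Let V be a set, let 𝓔, 𝓕 be families of finite subsets of V, and let n > 0 be a natural number. Then the following are equivalent: (1) ⟨V, 𝓔, 𝓕⟩ fails to have Property S; (2) the empty set belongs to [𝓔, 𝓕, n]; (3) the empty set belongs to [𝓕, 𝓔, n]. -/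
/-- `⟨V, 𝓔, 𝓕⟩` has Property S: there is an `X ⊆ V` meeting every member of `𝓔`
whose complement meets every member of `𝓕`. (Here `V` is the whole type.) -/
def HasPropertyS {V : Type*} (𝓔 𝓕 : Set (Set V)) : Prop :=
  ∃ X : Set V, (∀ E ∈ 𝓔, (X ∩ E).Nonempty) ∧ (∀ F ∈ 𝓕, (Xᶜ ∩ F).Nonempty)

/-- The iterated closures `[𝓔,𝓕,n]`:
`[𝓔,𝓕,0] = 𝓔` and `[𝓔,𝓕,n+1] = [𝓔]_{[𝓕,𝓔,n]}`. -/
def iterResSet {V : Type*} : Set (Set V) → Set (Set V) → ℕ → Set (Set V)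
  | 𝓔, _, 0 => 𝓔
  | 𝓔, 𝓕, n + 1 => resSet 𝓔 (iterResSet 𝓕 𝓔 n)

/-- Property S is symmetric in the two families, by passing to the complement. -/
theorem HasPropertyS.symm {V : Type*} {𝓔 𝓕 : Set (Set V)} (h : HasPropertyS 𝓔 𝓕) :
    HasPropertyS 𝓕 𝓔 := by
  obtain ⟨X, hXE, hXF⟩ := h
  exact ⟨Xᶜ, hXF, by simpa using hXE⟩

theorem subset_resSet {V : Type*} (𝓐 𝓓 : Set (Set V)) : 𝓐 ⊆ resSet 𝓐 𝓓 :=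
  fun _ hc => ResClosure.base hc

theorem resSet_mono_right {V : Type*} {𝓐 𝓓 𝓓' : Set (Set V)} (h : 𝓓 ⊆ 𝓓') :
    resSet 𝓐 𝓓 ⊆ resSet 𝓐 𝓓' := by
  intro e he
  induction he with
  | base hc => exact .base hc
  | res hd c hmem _ ih => exact .res (h hd) c hmem ih

/-- Resolution preserves being met by a set whose complement meets every resolved-on set. -/
theorem inter_nonempty_of_mem_resSet {V : Type*} {𝓐 𝓓 : Set (Set V)} {X : Set V}
    (hA : ∀ a ∈ 𝓐, (X ∩ a).Nonempty) (hD : ∀ d ∈ 𝓓, (Xᶜ ∩ d).Nonempty)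
    {e : Set V} (he : e ∈ resSet 𝓐 𝓓) : (X ∩ e).Nonempty := by
  induction he with
  | base hc => exact hA _ hc
  | res hd c _ _ ih =>
    obtain ⟨v, hvX, hvd⟩ := hD _ hd
    obtain ⟨w, hwX, hwc⟩ := ih v hvd
    refine ⟨w, hwX, Set.mem_biUnion hvd ⟨hwc, ?_⟩⟩
    rintro rfl
    exact hvX hwX

theorem finite_of_mem_resSet {V : Type*} {𝓐 𝓓 : Set (Set V)}
    (hA : ∀ a ∈ 𝓐, a.Finite) (hD : ∀ d ∈ 𝓓, d.Finite)
    {e : Set V} (he : e ∈ resSet 𝓐 𝓓) : e.Finite := by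
  induction he with
  | base hc => exact hA _ hc
  | res hd c _ _ ih => exact (hD _ hd).biUnion fun v hv => (ih v hv).sdiff

theorem inter_nonempty_of_mem_iterResSet {V : Type*} (n : ℕ) :
    ∀ {𝓔 𝓕 : Set (Set V)} {X : Set V}, (∀ E ∈ 𝓔, (X ∩ E).Nonempty) →
      (∀ F ∈ 𝓕, (Xᶜ ∩ F).Nonempty) → ∀ e ∈ iterResSet 𝓔 𝓕 n, (X ∩ e).Nonempty := by
  induction n with
  | zero => exact fun hE _ => hE
  | succ n ih =>
    intro 𝓔 𝓕 X hE hF e he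
    exact inter_nonempty_of_mem_resSet hE (ih hF (by simpa using hE)) he

theorem subset_iterResSet {V : Type*} (𝓔 𝓕 : Set (Set V)) (n : ℕ) :
    𝓔 ⊆ iterResSet 𝓔 𝓕 n := by
  cases n with
  | zero => exact subset_rfl
  | succ n => exact subset_resSet _ _

/-- A family of finite nonempty sets admits a maximal set containing none of its members. -/
theorem exists_maximal_forall_not_subset {V : Type*} {𝓒 : Set (Set V)}
    (hfin : ∀ c ∈ 𝓒, c.Finite) (hne : ∅ ∉ 𝓒) :
    ∃ Y : Set V, Maximal (fun Y => ∀ c ∈ 𝓒, ¬ c ⊆ Y) Y := by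
  obtain ⟨Y, -, hY⟩ := zorn_subset_nonempty {Y : Set V | ∀ c ∈ 𝓒, ¬ c ⊆ Y}
    (fun S hS hchain hSne => ⟨⋃₀ S, fun c hc hsub => by
      obtain ⟨s, hs, hcs⟩ := hchain.directedOn.exists_mem_subset_of_finite_of_subset_sUnion
        hSne (hfin c hc) hsub
      exact hS hs c hc hcs, fun s hs => Set.subset_sUnion_of_mem hs⟩) ∅
    (fun c hc hsub => hne (Set.subset_empty_iff.mp hsub ▸ hc))
  exact ⟨Y, hY⟩

/-- Refutation completeness of resolution. -/
theorem hasPropertyS_of_empty_notMem_resSet {V : Type*} {𝓔 𝓕 : Set (Set V)}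
    (hE : ∀ E ∈ 𝓔, E.Finite) (hF : ∀ F ∈ 𝓕, F.Finite) (h : ∅ ∉ resSet 𝓔 𝓕) :
    HasPropertyS 𝓔 𝓕 := by
  obtain ⟨Y, hY, hmax⟩ :=
    exists_maximal_forall_not_subset (fun _ hc => finite_of_mem_resSet hE hF hc) h
  refine ⟨Yᶜ, fun E hEmem => ?_, fun F hFmem => ?_⟩
  · obtain ⟨v, hvE, hvY⟩ := Set.not_subset.mp (hY E (subset_resSet _ _ hEmem))
    exact ⟨v, hvY, hvE⟩
  · rw [compl_compl]
    by_contra hdisj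
    have hcov : ∀ v ∈ F, ∃ c ∈ resSet 𝓔 𝓕, c ⊆ insert v Y := by
      intro v hv
      by_contra! hno
      exact hdisj ⟨v, hmax hno (Set.subset_insert v Y) (Set.mem_insert v Y), hv⟩
    choose! c hc hcY using hcov
    refine hY _ (ResClosure.res hFmem c (fun v hv => ?_) hc) (Set.iUnion₂_subset fun v hv => ?_)
    · by_contra hvc
      exact hY _ (hc v hv) ((Set.subset_insert_iff_of_notMem hvc).mp (hcY v hv))
    · simpa [Set.sdiff_subset_iff] using hcY v hv

theorem not_hasPropertyS_iff_empty_mem_iterResSet {V : Type*} {𝓔 𝓕 : Set (Set V)}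
    (hE : ∀ E ∈ 𝓔, E.Finite) (hF : ∀ F ∈ 𝓕, F.Finite) {n : ℕ} (hn : 0 < n) :
    ¬ HasPropertyS 𝓔 𝓕 ↔ ∅ ∈ iterResSet 𝓔 𝓕 n := by
  constructor
  · intro h
    obtain ⟨m, rfl⟩ := Nat.exists_eq_succ_of_ne_zero hn.ne'
    refine resSet_mono_right (subset_iterResSet 𝓕 𝓔 m) ?_
    by_contra hempty
    exact h (hasPropertyS_of_empty_notMem_resSet hE hF hempty)
  · rintro hempty ⟨X, hXE, hXF⟩
    simpa using inter_nonempty_of_mem_iterResSet n hXE hXF ∅ hempty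

/-- For `n > 0`, failure of Property S, `∅ ∈ [𝓔,𝓕,n]` and `∅ ∈ [𝓕,𝓔,n]`
are all equivalent. -/
theorem not_propertyS_tfae_empty_mem_iterResSet {V : Type*} (𝓔 𝓕 : Set (Set V))
    (hE : ∀ E ∈ 𝓔, E.Finite) (hF : ∀ F ∈ 𝓕, F.Finite) (n : ℕ) (hn : 0 < n) :
    [¬ HasPropertyS 𝓔 𝓕,
      ∅ ∈ iterResSet 𝓔 𝓕 n,
      ∅ ∈ iterResSet 𝓕 𝓔 n].TFAE := by
  have h₁ := not_hasPropertyS_iff_empty_mem_iterResSet hE hF hn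
  have h₂ := not_hasPropertyS_iff_empty_mem_iterResSet hF hE hn
  have hsymm : ¬ HasPropertyS 𝓔 𝓕 ↔ ¬ HasPropertyS 𝓕 𝓔 :=
    not_congr ⟨HasPropertyS.symm, HasPropertyS.symm⟩
  tfae_have 1 ↔ 2 := h₁
  tfae_have 1 ↔ 3 := hsymm.trans h₂
  tfae_finish
end
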